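/- Let k be an algebraically closed field of characteristic 0 and let f ∈ k[x_0,x_1,x_2,x_3] be a homogeneous polynomial of degree d ≥ 3 defining a smooth surface S = V(f) ⊂ P³ (i.e. there is no a ∈ k⁴ ∖ {0} with f(a) = 0 and ∂_i f(a) = 0 for all i). Then there exists a homogeneous polynomial F ∈ k[x_0,x_1,x_2,x_3] of degree 11d − 24 such that for every a ∈ k⁴ ∖ {0} with f(a) = 0, one has F(a) = 0 if and only if there exists b ∈ k⁴, linearly independent from a, such that β⁴ divides f(α·a + β·b) in the polynomial ring k[α,β] (i.e. the line through a and b intersects S with multiplicity at least 4 at the point a). -/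

import Mathlib

open MvPolynomial

namespace Flecnodal

open Matrix
open scoped Kronecker

section Tensor

variable {n R : Type*} [Fintype n] [CommRing R]

/-- The action of the matrix `N` on cubic tensors, one copy of `N` for each slot. -/
def tensorAct (N : Matrix n n R) (T : n × n × n → R) : n × n × n → R :=
  (N ⊗ₖ (N ⊗ₖ N)) *ᵥ T

/-- The contraction of the last two slots of `T` against `U`. -/
def tensorTrace (U : Matrix n n R) (T : n × n × n → R) : n → R :=
  fun i => ∑ j, ∑ l, U j l * T (i, j, l)

/-- The combination `4‖T‖² - 3‖tr T‖²`, all contractions being taken with respect to `U`. For a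
nondegenerate form in two variables this is proportional to the squared norm of the trace-free part
of the symmetric tensor `T`. -/
def flecnodalForm (U : Matrix n n R) (T : n × n × n → R) : R :=
  4 * (T ⬝ᵥ tensorAct U T) - 3 * (tensorTrace U T ⬝ᵥ U *ᵥ tensorTrace U T)

/-- The cubic form attached to the tensor `T`. -/
def cubicForm (T : n × n × n → R) (b : n → R) : R :=
  ∑ i, ∑ j, ∑ l, b i * (b j * (b l * T (i, j, l)))

theorem tensorAct_apply (N : Matrix n n R) (T : n × n × n → R) (x y z : n) :
    tensorAct N T (x, y, z) = ∑ i, N x i * ∑ j, N y j * ∑ l, N z l * T (i, j, l) := by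
  simp only [tensorAct, mulVec, dotProduct, Fintype.sum_prod_type, kroneckerMap_apply,
    Finset.mul_sum, mul_assoc]

theorem tensorAct_swap_left (N : Matrix n n R) {T : n × n × n → R}
    (h : ∀ x y z, T (x, y, z) = T (y, x, z)) (x y z : n) :
    tensorAct N T (x, y, z) = tensorAct N T (y, x, z) := by
  simp only [tensorAct_apply, Finset.mul_sum]
  rw [Finset.sum_comm]
  refine Finset.sum_congr rfl fun i _ => Finset.sum_congr rfl fun j _ =>
    Finset.sum_congr rfl fun l _ => ?_
  rw [h, mul_left_comm]

theorem tensorAct_swap_right (N : Matrix n n R) {T : n × n × n → R}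
    (h : ∀ x y z, T (x, y, z) = T (x, z, y)) (x y z : n) :
    tensorAct N T (x, y, z) = tensorAct N T (x, z, y) := by
  simp only [tensorAct_apply]
  refine Finset.sum_congr rfl fun i _ => congrArg _ ?_
  simp only [Finset.mul_sum]
  rw [Finset.sum_comm]
  simp only [h i, mul_left_comm]

theorem cubicForm_tensorAct (N : Matrix n n R) (T : n × n × n → R) (c : n → R) :
    cubicForm (tensorAct N T) c = cubicForm T (c ᵥ* N) := by
  have h1 (b : n → R) (T : n × n × n → R) : cubicForm T b =
      (fun p : n × n × n => b p.1 * (b p.2.1 * b p.2.2)) ⬝ᵥ T := by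
    simp only [cubicForm, dotProduct, Fintype.sum_prod_type, mul_assoc]
  rw [h1, h1, tensorAct, dotProduct_mulVec]
  congr 1
  ext ⟨i, j, l⟩
  simp only [vecMul, dotProduct, Fintype.sum_prod_type, kroneckerMap_apply]
  rw [Finset.sum_mul_sum, Finset.sum_mul_sum]
  simp only [Finset.mul_sum]
  exact Finset.sum_congr rfl fun _ _ => Finset.sum_congr rfl fun _ _ =>
    Finset.sum_congr rfl fun _ _ => by ring

theorem tensorTrace_conj (N U : Matrix n n R) (T : n × n × n → R) :
    N *ᵥ tensorTrace (Nᵀ * U * N) T = tensorTrace U (tensorAct N T) := by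
  have key (V M : Matrix n n R) : ∑ j, ∑ l, V j l * M j l = trace (V * Mᵀ) := by
    simp [trace, mul_apply]
  have h (i : n) : tensorTrace (Nᵀ * U * N) T i =
      ∑ y, ∑ z, U y z * ∑ j, N y j * ∑ l, N z l * T (i, j, l) := by
    let M : Matrix n n R := of fun j l => T (i, j, l)
    have hM (y z : n) : ∑ j, N y j * ∑ l, N z l * T (i, j, l) = (N * (M * Nᵀ)) y z := by
      simp [M, mul_apply, mul_comm]
    calc tensorTrace (Nᵀ * U * N) T i = trace (Nᵀ * U * N * Mᵀ) := key _ M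
      _ = trace (U * (N * (M * Nᵀ))ᵀ) := by
        simp only [transpose_mul, transpose_transpose, Matrix.mul_assoc]
        rw [trace_mul_comm]
        simp only [Matrix.mul_assoc]
      _ = _ := by simp only [← key, hM]
  have hcomm (c : n → R) (S : n → n → n → R) :
      ∑ i, c i * ∑ y, ∑ z, U y z * S i y z = ∑ y, ∑ z, U y z * ∑ i, c i * S i y z := by
    simp only [Finset.mul_sum]
    rw [Finset.sum_comm]
    refine Finset.sum_congr rfl fun y _ => ?_
    rw [Finset.sum_comm]
    exact Finset.sum_congr rfl fun z _ => Finset.sum_congr rfl fun i _ => by ring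
  ext x
  simp only [mulVec, dotProduct, h]
  simp only [tensorTrace, tensorAct_apply]
  exact hcomm _ _

theorem flecnodalForm_conj (N U : Matrix n n R) (T : n × n × n → R) :
    flecnodalForm (Nᵀ * U * N) T = flecnodalForm U (tensorAct N T) := by
  have h (v : n → R) (V M : Matrix n n R) :
      v ⬝ᵥ (Mᵀ * V * M) *ᵥ v = (M *ᵥ v) ⬝ᵥ V *ᵥ (M *ᵥ v) := by
    rw [← mulVec_mulVec, ← mulVec_mulVec, dotProduct_mulVec, vecMul_transpose]
  have h' (v : n × n × n → R) (V M : Matrix (n × n × n) (n × n × n) R) :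
      v ⬝ᵥ (Mᵀ * V * M) *ᵥ v = (M *ᵥ v) ⬝ᵥ V *ᵥ (M *ᵥ v) := by
    rw [← mulVec_mulVec, ← mulVec_mulVec, dotProduct_mulVec, vecMul_transpose]
  rw [flecnodalForm, flecnodalForm, h, tensorTrace_conj]
  simp only [tensorAct]
  have e : (Nᵀ * U * N) ⊗ₖ ((Nᵀ * U * N) ⊗ₖ (Nᵀ * U * N)) =
      (N ⊗ₖ (N ⊗ₖ N))ᵀ * (U ⊗ₖ (U ⊗ₖ U)) * (N ⊗ₖ (N ⊗ₖ N)) := by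
    simp only [mul_kronecker_mul, ← kroneckerMap_transpose]
  rw [e, h']

theorem flecnodalForm_smul (c : R) (U : Matrix n n R) (T : n × n × n → R) :
    flecnodalForm (c • U) T = c ^ 3 * flecnodalForm U T := by
  have h : tensorTrace (c • U) T = c • tensorTrace U T := by
    ext; simp [tensorTrace, Finset.mul_sum, mul_assoc]
  rw [flecnodalForm, flecnodalForm, h]
  simp only [tensorAct, smul_kronecker, kronecker_smul, smul_mulVec, mulVec_smul, dotProduct_smul,
    smul_dotProduct, smul_eq_mul]
  ring

theorem map_flecnodalForm {S : Type*} [CommRing S] (φ : R →+* S) (U : Matrix n n R)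
    (T : n × n × n → R) :
    φ (flecnodalForm U T) = flecnodalForm (U.map φ) (φ ∘ T) := by
  simp [flecnodalForm, tensorAct, tensorTrace, dotProduct, mulVec, map_ofNat φ]

end Tensor

section Normal

variable {k : Type*} [Field k]

theorem flecnodalForm_normal (m p q : k) (T : Fin 4 × Fin 4 × Fin 4 → k)
    (h1 : ∀ x y z, T (x, y, z) = T (y, x, z)) (h2 : ∀ x y z, T (x, y, z) = T (x, z, y))
    (hT : ∀ y z, T (0, y, z) = m * !![0, 1, 0, 0; 1, 0, 0, 0; 0, 0, 0, p; 0, 0, p, q] y z) :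
    flecnodalForm (adjugate !![0, 1, 0, 0; 1, 0, 0, 0; 0, 0, 0, p; 0, 0, p, q]) T =
      T (2, 2, 2) * (8 * p ^ 3 * T (3, 3, 3) - 12 * p ^ 2 * q * T (2, 3, 3)
        + 6 * p * q ^ 2 * T (2, 2, 3) - q ^ 3 * T (2, 2, 2)) := by
  have hU : adjugate !![0, 1, 0, 0; 1, 0, 0, 0; 0, 0, 0, p; 0, 0, p, q] =
      !![0, p ^ 2, 0, 0; p ^ 2, 0, 0, 0; 0, 0, -q, p; 0, 0, p, 0] := by
    ext i j
    fin_cases i <;> fin_cases j <;>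
      simp [adjugate_fin_succ_eq_det_submatrix, det_fin_three, Fin.succAbove] <;> ring
  rw [hU]
  simp [flecnodalForm, tensorTrace, tensorAct_apply, dotProduct, mulVec, Fintype.sum_prod_type,
    Fin.sum_univ_four, hT, h1 _ 0, h2 _ _ 0]
  simp only [h1 2 1, h1 3 1, h1 3 2, h2 _ 2 1, h2 _ 3 1, h2 _ 3 2]
  ring

theorem dotProduct_mulVec_comm {A : Matrix (Fin 4) (Fin 4) k} (hA : A.IsSymm) (x y : Fin 4 → k) :
    x ⬝ᵥ A *ᵥ y = y ⬝ᵥ A *ᵥ x := by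
  rw [dotProduct_mulVec, ← mulVec_transpose, hA.eq, dotProduct_comm]

theorem exists_hyperbolic_partner [CharZero k] {A : Matrix (Fin 4) (Fin 4) k} (hA : A.IsSymm)
    {a : Fin 4 → k} (ha : A *ᵥ a ≠ 0) (haa : a ⬝ᵥ A *ᵥ a = 0) :
    ∃ w, a ⬝ᵥ A *ᵥ w = 1 ∧ w ⬝ᵥ A *ᵥ w = 0 := by
  obtain ⟨i, hi⟩ := Function.ne_iff.mp ha
  obtain ⟨w, hw⟩ : ∃ w, a ⬝ᵥ A *ᵥ w = 1 := by
    refine ⟨Pi.single i ((A *ᵥ a) i)⁻¹, ?_⟩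
    rw [dotProduct_mulVec_comm hA, single_dotProduct, inv_mul_cancel₀ hi]
  have hw' : w ⬝ᵥ A *ᵥ a = 1 := by rw [dotProduct_mulVec_comm hA, hw]
  refine ⟨w - (w ⬝ᵥ A *ᵥ w / 2) • a, ?_, ?_⟩
  · simp [mulVec_sub, mulVec_smul, haa, hw]
  · simp [mulVec_sub, mulVec_smul, haa, hw, hw']
    ring

theorem exists_linearIndependent_pair_orthogonal (A : Matrix (Fin 4) (Fin 4) k)
    (a w : Fin 4 → k) :
    ∃ u v : Fin 4 → k, LinearIndependent k ![u, v] ∧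
      (a ⬝ᵥ A *ᵥ u = 0 ∧ w ⬝ᵥ A *ᵥ u = 0) ∧ (a ⬝ᵥ A *ᵥ v = 0 ∧ w ⬝ᵥ A *ᵥ v = 0) := by
  let φ : (Fin 4 → k) →ₗ[k] (Fin 2 → k) := mulVecLin (of ![a, w] * A)
  have hφ (x : LinearMap.ker φ) : a ⬝ᵥ A *ᵥ x.1 = 0 ∧ w ⬝ᵥ A *ᵥ x.1 = 0 := by
    have hx : of ![a, w] *ᵥ (A *ᵥ x.1) = 0 := by simpa [φ] using x.2
    exact ⟨congrFun hx 0, congrFun hx 1⟩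
  have hrank := φ.finrank_range_add_finrank_ker
  have hle := Submodule.finrank_le (LinearMap.range φ)
  rw [Module.finrank_fin_fun] at hrank hle
  have hker : 1 < Module.finrank k (LinearMap.ker φ) := by omega
  have : Nontrivial (LinearMap.ker φ) := Module.nontrivial_of_finrank_pos (R := k) (by omega)
  obtain ⟨u, hu⟩ := exists_ne (0 : LinearMap.ker φ)
  obtain ⟨v, hv⟩ := exists_linearIndependent_pair_of_one_lt_finrank hker hu
  refine ⟨u, v, ?_, hφ u, hφ v⟩
  rw [LinearIndependent.pair_iff] at hv ⊢
  exact fun s t h => hv s t (Subtype.ext h)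

end Normal

section Solve

variable {k : Type*} [Field k] [IsAlgClosed k] [CharZero k]

theorem exists_binary_quadratic_eq_zero (a b c : k) :
    ∃ s t : k, (s ≠ 0 ∨ t ≠ 0) ∧ a * s ^ 2 + b * s * t + c * t ^ 2 = 0 := by
  by_cases ha : a = 0
  · exact ⟨1, 0, by simp [ha]⟩
  · obtain ⟨r, hr⟩ := IsAlgClosed.exists_pow_nat_eq (discrim a b c) two_pos
    obtain ⟨s, hs⟩ := exists_quadratic_eq_zero ha ⟨r, by rw [← hr, sq]⟩
    exact ⟨s, 1, by simp, by linear_combination hs⟩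

theorem exists_binary_cubic_eq_zero (a b c d : k) :
    ∃ s t : k, (s ≠ 0 ∨ t ≠ 0) ∧
      a * s ^ 3 + b * s ^ 2 * t + c * s * t ^ 2 + d * t ^ 3 = 0 := by
  by_cases ha : a = 0
  · exact ⟨1, 0, by simp [ha]⟩
  · obtain ⟨s, hs⟩ := IsAlgClosed.exists_root (Cubic.toPoly ⟨a, b, c, d⟩)
      (by rw [Cubic.degree_of_a_ne_zero ha]; decide)
    simp [Cubic.toPoly] at hs
    exact ⟨s, 1, by simp, by linear_combination hs⟩

theorem binary_condition_iff (p q t0 t1 t2 t3 : k) :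
    t0 * (8 * p ^ 3 * t3 - 12 * p ^ 2 * q * t2 + 6 * p * q ^ 2 * t1 - q ^ 3 * t0) = 0 ↔
      ∃ s t : k, (s ≠ 0 ∨ t ≠ 0) ∧ t * (2 * p * s + q * t) = 0 ∧
        t0 * s ^ 3 + 3 * t1 * s ^ 2 * t + 3 * t2 * s * t ^ 2 + t3 * t ^ 3 = 0 := by
  constructor
  · intro h
    rcases mul_eq_zero.mp h with h | h
    · exact ⟨1, 0, by simp [h]⟩
    · by_cases hpq : p = 0 ∧ q = 0
      · obtain ⟨s, t, hst, h⟩ := exists_binary_cubic_eq_zero t0 (3 * t1) (3 * t2) t3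
        exact ⟨s, t, hst, by simp [hpq], h⟩
      · refine ⟨-q, 2 * p, ?_, by ring, by linear_combination h⟩
        by_contra! h0
        simp_all
  · rintro ⟨s, t, hst, h1, h2⟩
    rcases mul_eq_zero.mp h1 with rfl | h1
    · simp_all
    · by_cases ht : t = 0
      · subst ht
        simp_all
      · have h3 : t ^ 3 * (8 * p ^ 3 * t3 - 12 * p ^ 2 * q * t2 + 6 * p * q ^ 2 * t1
            - q ^ 3 * t0) = 0 := by
          have e : q * t = -(2 * p * s) := by linear_combination h1
          calc _ = 8 * p ^ 3 * t3 * t ^ 3 - 12 * p ^ 2 * (q * t) * t2 * t ^ 2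
                + 6 * p * (q * t) ^ 2 * t1 * t - (q * t) ^ 3 * t0 := by ring
            _ = 0 := by rw [e]; linear_combination 8 * p ^ 3 * h2
        rw [(mul_eq_zero.mp h3).resolve_left (pow_ne_zero _ ht), mul_zero]

theorem flecnodalForm_normal_eq_zero_iff (m p q : k) (T : Fin 4 × Fin 4 × Fin 4 → k)
    (h1 : ∀ x y z, T (x, y, z) = T (y, x, z)) (h2 : ∀ x y z, T (x, y, z) = T (x, z, y))
    (hT : ∀ y z, T (0, y, z) = m * !![0, 1, 0, 0; 1, 0, 0, 0; 0, 0, 0, p; 0, 0, p, q] y z) :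
    flecnodalForm (adjugate !![0, 1, 0, 0; 1, 0, 0, 0; 0, 0, 0, p; 0, 0, p, q]) T = 0 ↔
      ∃ c : Fin 4 → k, (c 2 ≠ 0 ∨ c 3 ≠ 0) ∧
        ![1, 0, 0, 0] ⬝ᵥ !![0, 1, 0, 0; 1, 0, 0, 0; 0, 0, 0, p; 0, 0, p, q] *ᵥ c = 0 ∧
        c ⬝ᵥ !![0, 1, 0, 0; 1, 0, 0, 0; 0, 0, 0, p; 0, 0, p, q] *ᵥ c = 0 ∧
        cubicForm T c = 0 := by
  rw [flecnodalForm_normal m p q T h1 h2 hT, binary_condition_iff]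
  have hquad (c : Fin 4 → k) (hc : c 1 = 0) :
      c ⬝ᵥ !![0, 1, 0, 0; 1, 0, 0, 0; 0, 0, 0, p; 0, 0, p, q] *ᵥ c =
        c 3 * (2 * p * c 2 + q * c 3) := by
    simp [dotProduct, mulVec, Fin.sum_univ_four, hc]; ring
  have hcub (c : Fin 4 → k) (hc : c 1 = 0) (hc' : c 3 * (2 * p * c 2 + q * c 3) = 0) :
      cubicForm T c = T (2, 2, 2) * c 2 ^ 3 + 3 * T (2, 2, 3) * c 2 ^ 2 * c 3
        + 3 * T (2, 3, 3) * c 2 * c 3 ^ 2 + T (3, 3, 3) * c 3 ^ 3 := by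
    simp [cubicForm, Fin.sum_univ_four, hc, hT, h1 _ 0, h2 _ _ 0]
    simp only [h1 3 2, h2 _ 3 2]
    linear_combination 3 * c 0 * m * hc'
  have hlin (c : Fin 4 → k) :
      ![1, 0, 0, 0] ⬝ᵥ !![0, 1, 0, 0; 1, 0, 0, 0; 0, 0, 0, p; 0, 0, p, q] *ᵥ c = c 1 := by
    simp [dotProduct, mulVec, Fin.sum_univ_four]
  constructor
  · rintro ⟨s, t, hst, hq, hc⟩
    refine ⟨![0, 0, s, t], hst, hlin _, ?_, ?_⟩
    · rw [hquad _ rfl]; exact hq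
    · rw [hcub _ rfl hq]; exact hc
  · rintro ⟨c, hst, hl, hq, hc⟩
    rw [hlin] at hl
    rw [hquad c hl] at hq
    rw [hcub c hl hq] at hc
    exact ⟨c 2, c 3, hst, hq, hc⟩

theorem exists_isotropic_orthogonal {A : Matrix (Fin 4) (Fin 4) k} (hA : A.IsSymm)
    (a w : Fin 4 → k) :
    ∃ u v : Fin 4 → k, u ⬝ᵥ A *ᵥ u = 0 ∧ LinearIndependent k ![u, v] ∧
      (a ⬝ᵥ A *ᵥ u = 0 ∧ w ⬝ᵥ A *ᵥ u = 0) ∧ (a ⬝ᵥ A *ᵥ v = 0 ∧ w ⬝ᵥ A *ᵥ v = 0) := by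
  obtain ⟨u, v, hli, hu, hv⟩ := exists_linearIndependent_pair_orthogonal A a w
  obtain ⟨s, t, hst, h⟩ := exists_binary_quadratic_eq_zero (u ⬝ᵥ A *ᵥ u)
    (2 * (u ⬝ᵥ A *ᵥ v)) (v ⬝ᵥ A *ᵥ v)
  have hnull : (s • u + t • v) ⬝ᵥ A *ᵥ (s • u + t • v) = 0 := by
    simp only [mulVec_add, mulVec_smul, dotProduct_add, add_dotProduct, dotProduct_smul,
      smul_dotProduct, smul_eq_mul, dotProduct_mulVec_comm hA v u]
    linear_combination h
  have hperp : a ⬝ᵥ A *ᵥ (s • u + t • v) = 0 ∧ w ⬝ᵥ A *ᵥ (s • u + t • v) = 0 := by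
    simp [mulVec_add, mulVec_smul, hu, hv]
  rw [LinearIndependent.pair_iff] at hli
  rcases hst with hs | ht
  · refine ⟨s • u + t • v, v, hnull, ?_, hperp, hv⟩
    rw [LinearIndependent.pair_iff]
    intro x y hxy
    obtain ⟨h1, h2⟩ := hli (x * s) (x * t + y) (by rw [← hxy]; module)
    have hx : x = 0 := (mul_eq_zero.mp h1).resolve_right hs
    exact ⟨hx, by simpa [hx] using h2⟩
  · refine ⟨s • u + t • v, u, hnull, ?_, hperp, hu⟩
    rw [LinearIndependent.pair_iff]
    intro x y hxy
    obtain ⟨h1, h2⟩ := hli (x * s + y) (x * t) (by rw [← hxy]; module)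
    have hx : x = 0 := (mul_eq_zero.mp h2).resolve_right ht
    exact ⟨hx, by simpa [hx] using h1⟩

theorem exists_normalizing_basis {A : Matrix (Fin 4) (Fin 4) k} (hA : A.IsSymm) {a : Fin 4 → k}
    (ha : A *ᵥ a ≠ 0) (haa : a ⬝ᵥ A *ᵥ a = 0) :
    ∃ (N : Matrix (Fin 4) (Fin 4) k) (p q : k), IsUnit N ∧ N 0 = a ∧
      N * A * Nᵀ = !![0, 1, 0, 0; 1, 0, 0, 0; 0, 0, 0, p; 0, 0, p, q] := by
  have hsymm := dotProduct_mulVec_comm hA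
  obtain ⟨w, haw, hww⟩ := exists_hyperbolic_partner hA ha haa
  obtain ⟨u, v, huu, hli, hu, hv⟩ := exists_isotropic_orthogonal hA a w
  have hwa : w ⬝ᵥ A *ᵥ a = 1 := by rw [hsymm, haw]
  refine ⟨of ![a, w, u, v], u ⬝ᵥ A *ᵥ v, v ⬝ᵥ A *ᵥ v, ?_, rfl, ?_⟩
  · rw [← linearIndependent_rows_iff_isUnit, Fintype.linearIndependent_iff]
    intro g hg
    replace hg : g 0 • a + g 1 • w + g 2 • u + g 3 • v = 0 := by
      rw [← hg, Fin.sum_univ_four]; rfl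
    have hga := congrArg (fun x => a ⬝ᵥ A *ᵥ x) hg
    have hgw := congrArg (fun x => w ⬝ᵥ A *ᵥ x) hg
    simp [mulVec_add, mulVec_smul, haa, haw, hwa, hww, hu, hv] at hga hgw
    have := LinearIndependent.pair_iff.mp hli (g 2) (g 3) (by simpa [hga, hgw] using hg)
    intro i
    fin_cases i <;> simp [hga, hgw, this]
  · have entry (i j : Fin 4) : (of ![a, w, u, v] * A * (of ![a, w, u, v])ᵀ) i j =
        ![a, w, u, v] i ⬝ᵥ A *ᵥ ![a, w, u, v] j := by
      rw [Matrix.mul_assoc]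
      rfl
    ext i j
    rw [entry]
    fin_cases i <;> fin_cases j <;>
      simp [haa, haw, hwa, hww, hu, hv, huu, hsymm u a, hsymm u w, hsymm v a, hsymm v w, hsymm v u]

theorem flecnodalForm_adjugate_eq_zero_iff {A : Matrix (Fin 4) (Fin 4) k} (hA : A.IsSymm)
    {a : Fin 4 → k} (ha : A *ᵥ a ≠ 0) (haa : a ⬝ᵥ A *ᵥ a = 0) (m : k)
    (T : Fin 4 × Fin 4 × Fin 4 → k)
    (h1 : ∀ x y z, T (x, y, z) = T (y, x, z)) (h2 : ∀ x y z, T (x, y, z) = T (x, z, y))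
    (hT : ∀ y z, ∑ i, a i * T (i, y, z) = m * A y z) :
    flecnodalForm (adjugate A) T = 0 ↔
      ∃ b : Fin 4 → k, LinearIndependent k ![a, b] ∧ a ⬝ᵥ A *ᵥ b = 0 ∧ b ⬝ᵥ A *ᵥ b = 0 ∧
        cubicForm T b = 0 := by
  obtain ⟨N, p, q, hN, hNa, hNA⟩ := exists_normalizing_basis hA ha haa
  have hdet : N.det ≠ 0 := ((isUnit_iff_isUnit_det N).mp hN).ne_zero
  have hadj : N.det ^ 2 • adjugate A = Nᵀ * adjugate (N * A * Nᵀ) * N := by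
    calc _ = (Nᵀ * adjugate Nᵀ) * adjugate A * (adjugate N * N) := by
          rw [mul_adjugate, adjugate_mul, det_transpose]
          simp [smul_smul, sq]
      _ = _ := by simp only [adjugate_mul_distrib, Matrix.mul_assoc]
  have hform : flecnodalForm (adjugate A) T = 0 ↔
      flecnodalForm (adjugate (N * A * Nᵀ)) (tensorAct N T) = 0 := by
    rw [← flecnodalForm_conj, ← hadj, flecnodalForm_smul]
    simp [hdet]
  have hbil (c c' : Fin 4 → k) :
      c ⬝ᵥ (N * A * Nᵀ) *ᵥ c' = (c ᵥ* N) ⬝ᵥ A *ᵥ (c' ᵥ* N) := by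
    rw [← mulVec_mulVec, ← mulVec_mulVec, dotProduct_mulVec, mulVec_transpose]
  have he : (![1, 0, 0, 0] : Fin 4 → k) ᵥ* N = a := by
    rw [← hNa]; ext j; simp [vecMul, dotProduct, Fin.sum_univ_four]
  have hinj : Function.Injective (fun c : Fin 4 → k => c ᵥ* N) := vecMul_injective_of_isUnit hN
  have hsurj : Function.Surjective (fun c : Fin 4 → k => c ᵥ* N) :=
    vecMul_surjective_iff_isUnit.mpr hN
  have hli (c : Fin 4 → k) (hc : c 1 = 0) :
      LinearIndependent k ![a, c ᵥ* N] ↔ c 2 ≠ 0 ∨ c 3 ≠ 0 := by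
    rw [LinearIndependent.pair_iff]
    constructor
    · intro h
      by_contra! h0
      have := h (- c 0) 1 (by
        rw [← he, ← smul_vecMul, ← smul_vecMul, ← add_vecMul]
        convert zero_vecMul N
        ext i
        fin_cases i <;> simp [h0, hc])
      exact one_ne_zero this.2
    · intro h s t hst
      rw [← he, ← smul_vecMul, ← smul_vecMul, ← add_vecMul] at hst
      have h0 : s • ![1, 0, 0, 0] + t • c = 0 := hinj (hst.trans (zero_vecMul N).symm)
      have e0 := congrFun h0 0
      have e2 := congrFun h0 2
      have e3 := congrFun h0 3
      simp at e0 e2 e3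
      have ht : t = 0 := by tauto
      simp_all
  have hlin (c : Fin 4 → k) : a ⬝ᵥ A *ᵥ (c ᵥ* N) = c 1 := by
    rw [← he, ← hbil, hNA]
    simp [dotProduct, mulVec, Fin.sum_univ_four]
  rw [hform, hNA, flecnodalForm_normal_eq_zero_iff m p q (tensorAct N T)]
  · refine Iff.trans ?_ hsurj.exists.symm
    refine exists_congr fun c => ?_
    rw [← hNA, hbil, hbil, he, cubicForm_tensorAct]
    constructor
    · rintro ⟨h, hl, hq⟩
      exact ⟨(hli c ((hlin c).symm.trans hl)).mpr h, hl, hq⟩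
    · rintro ⟨h, hl, hq⟩
      exact ⟨(hli c ((hlin c).symm.trans hl)).mp h, hl, hq⟩
  · exact tensorAct_swap_left N h1
  · exact tensorAct_swap_right N h2
  · intro y z
    rw [tensorAct_swap_left N h1, tensorAct_swap_right N h2, tensorAct_apply, ← hNA,
      Matrix.mul_assoc, mul_apply, Finset.mul_sum]
    refine Finset.sum_congr rfl fun i _ => ?_
    rw [mul_left_comm m]
    refine congrArg _ ?_
    rw [mul_apply, Finset.mul_sum]
    refine Finset.sum_congr rfl fun j _ => ?_
    rw [hNa, transpose_apply, mul_comm (A i j), mul_left_comm, ← hT]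
    simp only [h2 i j, h1 i _ j]

end Solve

section Polynomials

variable {k σ : Type*} [Field k] [Fintype σ]

theorem pderiv_comm {R τ : Type*} [CommRing R] (i j : τ) (g : MvPolynomial τ R) :
    pderiv i (pderiv j g) = pderiv j (pderiv i g) := by
  classical
  have h : ⁅(pderiv i : Derivation R (MvPolynomial τ R) (MvPolynomial τ R)),
      (pderiv j : Derivation R (MvPolynomial τ R) (MvPolynomial τ R))⁆ = 0 := by
    refine derivation_ext fun l => ?_
    rw [Derivation.commutator_apply, pderiv_X, pderiv_X, Pi.single_apply, Pi.single_apply]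
    split_ifs <;> simp
  rw [← sub_eq_zero, ← Derivation.commutator_apply, h, Derivation.zero_apply]

/-- The derivative in the direction `b`. -/
noncomputable def dirDeriv (b : σ → k) (g : MvPolynomial σ k) : MvPolynomial σ k :=
  ∑ i, C (b i) * pderiv i g

theorem dirDeriv_add (b : σ → k) (g h : MvPolynomial σ k) :
    dirDeriv b (g + h) = dirDeriv b g + dirDeriv b h := by
  simp [dirDeriv, mul_add, Finset.sum_add_distrib]

theorem dirDeriv_C_mul (b : σ → k) (c : k) (g : MvPolynomial σ k) :
    dirDeriv b (C c * g) = C c * dirDeriv b g := by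
  simp [dirDeriv, Finset.mul_sum, mul_left_comm]

theorem dirDeriv_mul_X (b : σ → k) (g : MvPolynomial σ k) (i : σ) :
    dirDeriv b (g * X i) = dirDeriv b g * X i + C (b i) * g := by
  classical
  simp only [dirDeriv, pderiv_mul, pderiv_X, Pi.single_apply, mul_add, Finset.sum_add_distrib,
    Finset.sum_mul, mul_ite, mul_one, mul_zero, Finset.sum_ite_eq, Finset.mem_univ, if_true,
    mul_assoc]

theorem isHomogeneous_dirDeriv {g : MvPolynomial σ k} {n : ℕ} (hg : g.IsHomogeneous n)
    (b : σ → k) : (dirDeriv b g).IsHomogeneous (n - 1) := by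
  refine IsHomogeneous.sum _ _ _ fun i _ => ?_
  simpa using (isHomogeneous_C σ (b i)).mul (hg.pderiv (i := i))

/-- Taylor's formula along a line, up to order four. -/
theorem taylor_line [CharZero k] (a b : σ → k) (g : MvPolynomial σ k) :
    ∃ r : MvPolynomial (Fin 2) k,
      aeval (fun i => C (a i) * X 0 + C (b i) * X 1) g =
        aeval (fun i => C (a i) * X 0) g
        + X 1 * aeval (fun i => C (a i) * X 0) (dirDeriv b g)
        + C (1 / 2) * X 1 ^ 2 * aeval (fun i => C (a i) * X 0) (dirDeriv b (dirDeriv b g))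
        + C (1 / 6) * X 1 ^ 3 *
          aeval (fun i => C (a i) * X 0) (dirDeriv b (dirDeriv b (dirDeriv b g)))
        + X 1 ^ 4 * r := by
  induction g using MvPolynomial.induction_on with
  | C c => exact ⟨0, by simp [dirDeriv]⟩
  | add g h hg hh =>
    obtain ⟨r, hr⟩ := hg
    obtain ⟨s, hs⟩ := hh
    refine ⟨r + s, ?_⟩
    simp only [dirDeriv_add, map_add, hr, hs]
    ring
  | mul_X g i hg =>
    obtain ⟨r, hr⟩ := hg
    refine ⟨C (1 / 6) * C (b i) * aeval (fun i => C (a i) * X 0)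
      (dirDeriv b (dirDeriv b (dirDeriv b g))) + r * (C (a i) * X 0 + C (b i) * X 1), ?_⟩
    have h2 : (C (1 / 2) : MvPolynomial (Fin 2) k) * 2 = 1 := by
      rw [← map_ofNat (C (R := k) (σ := Fin 2)) 2, ← C_mul]; simp
    have h6 : (C (1 / 6) : MvPolynomial (Fin 2) k) * 3 = C (1 / 2) := by
      rw [← map_ofNat (C (R := k) (σ := Fin 2)) 3, ← C_mul]; norm_num
    simp only [dirDeriv_add, dirDeriv_C_mul, dirDeriv_mul_X, map_add, map_mul, hr, aeval_X,
      algHom_C, algebraMap_eq]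
    linear_combination -(X 1 ^ 2 * C (b i) * aeval (fun i => C (a i) * X 0) (dirDeriv b g)) * h2
      - (X 1 ^ 3 * C (b i) * aeval (fun i => C (a i) * X 0) (dirDeriv b (dirDeriv b g))) * h6

theorem aeval_C_mul_X {g : MvPolynomial σ k} {n : ℕ} (hg : g.IsHomogeneous n) (a : σ → k) :
    aeval (fun i => (C (a i) * X 0 : MvPolynomial (Fin 2) k)) g = C (eval a g) * X 0 ^ n := by
  rw [aeval_def, eval₂_eq', eval_eq', map_sum, Finset.sum_mul]
  refine Finset.sum_congr rfl fun s hs => ?_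
  have hdeg : ∑ i, s i = n := by
    rw [← Finsupp.degree_eq_sum, Finsupp.degree_eq_weight_one]
    exact hg (mem_support_iff.mp hs)
  simp only [mul_pow, Finset.prod_mul_distrib, Finset.prod_pow_eq_pow_sum, hdeg, map_mul, map_prod,
    map_pow, algebraMap_eq, mul_assoc]

theorem X_pow_four_dvd_iff [CharZero k] {d : ℕ} {f : MvPolynomial σ k}
    (hf : f.IsHomogeneous d) (a b : σ → k) :
    (X 1 : MvPolynomial (Fin 2) k) ^ 4 ∣ aeval (fun i => C (a i) * X 0 + C (b i) * X 1) f ↔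
      eval a f = 0 ∧ eval a (dirDeriv b f) = 0 ∧ eval a (dirDeriv b (dirDeriv b f)) = 0 ∧
        eval a (dirDeriv b (dirDeriv b (dirDeriv b f))) = 0 := by
  obtain ⟨r, hr⟩ := taylor_line a b f
  have h1 := isHomogeneous_dirDeriv hf b
  have h2 := isHomogeneous_dirDeriv h1 b
  have h3 := isHomogeneous_dirDeriv h2 b
  rw [hr, dvd_add_left (dvd_mul_right _ _), aeval_C_mul_X hf, aeval_C_mul_X h1, aeval_C_mul_X h2,
    aeval_C_mul_X h3]
  constructor
  · intro h
    have h' := map_dvd (aeval ![1, Polynomial.X] : MvPolynomial (Fin 2) k →ₐ[k] Polynomial k) h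
    simp only [map_add, map_mul, map_pow, aeval_X, algHom_C, Matrix.cons_val_zero,
      Matrix.cons_val_one, one_pow, mul_one, Polynomial.algebraMap_eq] at h'
    rw [Polynomial.X_pow_dvd_iff] at h'
    refine ⟨?_, ?_, ?_, ?_⟩
    · simpa [Polynomial.coeff_X_pow, mul_assoc, Polynomial.coeff_C] using h' 0 (by norm_num)
    · simpa [Polynomial.coeff_X_pow, mul_assoc, Polynomial.coeff_C,
        Polynomial.coeff_X] using h' 1 (by norm_num)
    · simpa [Polynomial.coeff_X_pow, mul_assoc, Polynomial.coeff_C,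
        Polynomial.coeff_X] using h' 2 (by norm_num)
    · simpa [Polynomial.coeff_X_pow, mul_assoc, Polynomial.coeff_C,
        Polynomial.coeff_X] using h' 3 (by norm_num)
  · rintro ⟨e0, e1, e2, e3⟩
    simp [e0, e1, e2, e3]

theorem isHomogeneous_det {R τ : Type*} [CommRing R] {n : Type*} [Fintype n] [DecidableEq n]
    {M : Matrix n n (MvPolynomial τ R)} {e : ℕ} (hM : ∀ i j, (M i j).IsHomogeneous e) :
    M.det.IsHomogeneous (Fintype.card n * e) := by
  rw [det_apply]
  refine IsHomogeneous.sum _ _ _ fun s _ => ?_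
  rw [Units.smul_def, zsmul_eq_mul, ← map_intCast (C (R := R) (σ := τ))]
  have h := (isHomogeneous_C τ ((Equiv.Perm.sign s : ℤ) : R)).mul
    (IsHomogeneous.prod Finset.univ (fun i => M (s i) i) (fun _ => e) fun i _ => hM _ _)
  simpa using h

theorem isHomogeneous_adjugate {R τ : Type*} [CommRing R] {n e : ℕ}
    {M : Matrix (Fin (n + 1)) (Fin (n + 1)) (MvPolynomial τ R)}
    (hM : ∀ i j, (M i j).IsHomogeneous e) (i j : Fin (n + 1)) :
    (adjugate M i j).IsHomogeneous (n * e) := by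
  rw [adjugate_fin_succ_eq_det_submatrix, ← map_one (C (R := R) (σ := τ)), ← map_neg, ← map_pow]
  have h := (isHomogeneous_C τ ((-1 : R) ^ (j + i : ℕ))).mul
    (isHomogeneous_det (M := M.submatrix j.succAbove i.succAbove) fun _ _ => hM _ _)
  simpa using h

theorem isHomogeneous_flecnodalForm {R τ n : Type*} [CommRing R] [Fintype n]
    {U : Matrix n n (MvPolynomial τ R)} {T : n × n × n → MvPolynomial τ R} {u t : ℕ}
    (hU : ∀ i j, (U i j).IsHomogeneous u) (hT : ∀ x, (T x).IsHomogeneous t) :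
    (flecnodalForm U T).IsHomogeneous (3 * u + 2 * t) := by
  have hC (c : ℕ) [c.AtLeastTwo] {g : MvPolynomial τ R} {m : ℕ} (hg : g.IsHomogeneous m) :
      (ofNat(c) * g : MvPolynomial τ R).IsHomogeneous m := by
    rw [← map_ofNat (C (R := R) (σ := τ)) c]
    simpa using (isHomogeneous_C τ (OfNat.ofNat c : R)).mul hg
  have htr (i : n) : (tensorTrace U T i).IsHomogeneous (u + t) :=
    IsHomogeneous.sum _ _ _ fun _ _ => IsHomogeneous.sum _ _ _ fun _ _ => (hU _ _).mul (hT _)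
  refine (hC 4 ?_).sub (hC 3 ?_)
  · refine IsHomogeneous.sum _ _ _ fun x _ => ?_
    have h : (tensorAct U T x).IsHomogeneous (u + (u + u) + t) :=
      IsHomogeneous.sum _ _ _ fun y _ => ((hU _ _).mul ((hU _ _).mul (hU _ _))).mul (hT _)
    convert (hT x).mul h using 1
    ring
  · refine IsHomogeneous.sum _ _ _ fun x _ => ?_
    have h : ((U *ᵥ tensorTrace U T) x).IsHomogeneous (u + (u + t)) :=
      IsHomogeneous.sum _ _ _ fun y _ => (hU _ _).mul (htr _)
    convert (htr x).mul h using 1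
    ring

end Polynomials

section Surface

variable {k : Type*} [Field k]

/-- The Hessian matrix of `f`. -/
noncomputable def hessian (f : MvPolynomial (Fin 4) k) :
    Matrix (Fin 4) (Fin 4) (MvPolynomial (Fin 4) k) :=
  of fun i j => pderiv i (pderiv j f)

/-- The tensor of third partial derivatives of `f`. -/
noncomputable def thirdDeriv (f : MvPolynomial (Fin 4) k) :
    Fin 4 × Fin 4 × Fin 4 → MvPolynomial (Fin 4) k :=
  fun x => pderiv x.1 (pderiv x.2.1 (pderiv x.2.2 f))

/-- Clebsch's covariant of degree `11d - 24`, cutting out the flecnodal curve. -/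
noncomputable def flecnodalPolynomial (f : MvPolynomial (Fin 4) k) : MvPolynomial (Fin 4) k :=
  flecnodalForm (adjugate (hessian f)) (thirdDeriv f)

theorem isHomogeneous_flecnodalPolynomial {d : ℕ} (hd : 3 ≤ d) {f : MvPolynomial (Fin 4) k}
    (hf : f.IsHomogeneous d) : (flecnodalPolynomial f).IsHomogeneous (11 * d - 24) := by
  have h := isHomogeneous_flecnodalForm
    (isHomogeneous_adjugate (n := 3) (M := hessian f) fun i j =>
      (hf.pderiv (i := j)).pderiv (i := i))
    (T := thirdDeriv f) fun x =>
      ((hf.pderiv (i := x.2.2)).pderiv (i := x.2.1)).pderiv (i := x.1)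
  have e : 11 * d - 24 = 3 * (3 * (d - 1 - 1)) + 2 * (d - 1 - 1 - 1) := by omega
  rw [e]
  exact h

theorem eval_flecnodalPolynomial (f : MvPolynomial (Fin 4) k) (a : Fin 4 → k) :
    eval a (flecnodalPolynomial f) =
      flecnodalForm (adjugate ((hessian f).map (eval a))) (eval a ∘ thirdDeriv f) := by
  rw [flecnodalPolynomial, map_flecnodalForm]
  congr 1
  exact (eval a).map_adjugate (hessian f)

theorem sum_mul_eval_pderiv {g : MvPolynomial (Fin 4) k} {n : ℕ} (hg : g.IsHomogeneous n)
    (a : Fin 4 → k) : ∑ i, a i * eval a (pderiv i g) = n * eval a g := by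
  simpa using congrArg (eval a) hg.sum_X_mul_pderiv

theorem hessian_mulVec {f : MvPolynomial (Fin 4) k} {d : ℕ} (hf : f.IsHomogeneous d)
    (a : Fin 4 → k) (i : Fin 4) :
    ((hessian f).map (eval a) *ᵥ a) i = (d - 1 : ℕ) * eval a (pderiv i f) := by
  rw [← sum_mul_eval_pderiv (hf.pderiv (i := i)) a]
  simp [mulVec, dotProduct, hessian, pderiv_comm i, mul_comm]

theorem isSymm_hessian (f : MvPolynomial (Fin 4) k) (a : Fin 4 → k) :
    ((hessian f).map (eval a)).IsSymm := by
  ext i j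
  simp [hessian, pderiv_comm i j]

theorem eval_flecnodalPolynomial_eq_zero_iff [IsAlgClosed k] [CharZero k] {d : ℕ} (hd : 2 ≤ d)
    {f : MvPolynomial (Fin 4) k} (hf : f.IsHomogeneous d) {a : Fin 4 → k} (ha : eval a f = 0)
    (hgrad : ∃ i, eval a (pderiv i f) ≠ 0) :
    eval a (flecnodalPolynomial f) = 0 ↔
      ∃ b : Fin 4 → k, LinearIndependent k ![a, b] ∧
        (X 1 : MvPolynomial (Fin 2) k) ^ 4 ∣
          aeval (fun i => C (a i) * X 0 + C (b i) * X 1) f := by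
  have hd' : ((d - 1 : ℕ) : k) ≠ 0 := Nat.cast_ne_zero.mpr (by omega)
  have hlin (b : Fin 4 → k) : b ⬝ᵥ (hessian f).map (eval a) *ᵥ a =
      (d - 1 : ℕ) * eval a (dirDeriv b f) := by
    simp [dotProduct, hessian_mulVec hf, dirDeriv, Finset.mul_sum, mul_left_comm]
  have hHa : (hessian f).map (eval a) *ᵥ a ≠ 0 := by
    obtain ⟨i, hi⟩ := hgrad
    refine fun h => mul_ne_zero hd' hi ?_
    rw [← hessian_mulVec hf, h, Pi.zero_apply]
  have haa : a ⬝ᵥ (hessian f).map (eval a) *ᵥ a = 0 := by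
    have := sum_mul_eval_pderiv hf a
    rw [hlin]
    simp [dirDeriv, this, ha]
  rw [eval_flecnodalPolynomial,
    flecnodalForm_adjugate_eq_zero_iff (isSymm_hessian f a) hHa haa ((d - 1 - 1 : ℕ) : k)]
  · refine exists_congr fun b => and_congr_right fun _ => ?_
    rw [X_pow_four_dvd_iff hf, dotProduct_mulVec_comm (isSymm_hessian f a), hlin]
    have h2 : eval a (dirDeriv b (dirDeriv b f)) = b ⬝ᵥ (hessian f).map (eval a) *ᵥ b := by
      simp [dirDeriv, dotProduct, mulVec, hessian, mul_comm]
    have h3 : eval a (dirDeriv b (dirDeriv b (dirDeriv b f))) =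
        cubicForm (eval a ∘ thirdDeriv f) b := by
      simp [dirDeriv, cubicForm, thirdDeriv, Finset.mul_sum]
    simp [h2, h3, ha, hd']
  · intro x y z
    simp [thirdDeriv, pderiv_comm x y]
  · intro x y z
    simp [thirdDeriv, pderiv_comm y z]
  · intro y z
    exact sum_mul_eval_pderiv ((hf.pderiv (i := z)).pderiv (i := y)) a

end Surface

end Flecnodal

/-- flecnodal polynomial. Let `k` be an algebraically closed field of
characteristic `0` and `S = V(f) ⊂ P³` a smooth surface of degree `d ≥ 3`. There is a
homogeneous polynomial `F` of degree `11d − 24` such that for every point `a` of `S`,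
`F(a) = 0` if and only if there is a line through `a` (spanned by `a` and a point `b`
linearly independent from `a`) meeting `S` with multiplicity at least `4` at `a`, i.e.
such that `β⁴` divides `f(α·a + β·b)` in `k[α, β]`. -/
theorem statement_18 (k : Type*) [Field k] [IsAlgClosed k] [CharZero k]
    (d : ℕ) (hd : 3 ≤ d) (f : MvPolynomial (Fin 4) k) (hf : f.IsHomogeneous d)
    (hsmooth : ¬ ∃ a : Fin 4 → k, a ≠ 0 ∧ eval a f = 0 ∧ ∀ i, eval a (pderiv i f) = 0) :
    ∃ F : MvPolynomial (Fin 4) k, F.IsHomogeneous (11 * d - 24) ∧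
      ∀ a : Fin 4 → k, a ≠ 0 → eval a f = 0 →
        (eval a F = 0 ↔
          ∃ b : Fin 4 → k, LinearIndependent k ![a, b] ∧
            (X 1 : MvPolynomial (Fin 2) k) ^ 4 ∣
              aeval (fun i => C (a i) * X 0 + C (b i) * X 1) f) := by
  refine ⟨Flecnodal.flecnodalPolynomial f, Flecnodal.isHomogeneous_flecnodalPolynomial hd hf,
    fun a ha hfa => ?_⟩
  refine Flecnodal.eval_flecnodalPolynomial_eq_zero_iff (by omega) hf hfa ?_
  by_contra! hgrad
  exact hsmooth ⟨a, ha, hfa, hgrad⟩
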